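/- arXiv:2602.16283 — 4 statements merged into one kernel-verified Lean document; each statement's English description precedes it below -/
import Mathlib

section
/- Let μ ∈ ℝ and σ > 0. Then the Fisher information entry i_{σσ} of the Gumbel(μ,σ) distribution satisfies ∫_ℝ (s_σ(x;μ,σ))² · f(x;μ,σ) dx = (π²/6 + γ² − 2γ + 1)/σ², where γ is the Euler–Mascheroni constant. -/
open MeasureTheory Real

/-- Gumbel(μ,σ) density. -/
noncomputable def gumbelPdf (μ σ x : ℝ) : ℝ :=
  (1 / σ) * Real.exp (-((x - μ) / σ)) * Real.exp (-Real.exp (-((x - μ) / σ)))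

/-- Score of the Gumbel distribution with respect to the scale parameter σ. -/
noncomputable def gumbelScoreSigma (μ σ x : ℝ) : ℝ :=
  ((x - μ) / σ ^ 2) * (1 - Real.exp (-((x - μ) / σ))) - 1 / σ

/-- The function `(log t)^k * exp (-t)`, complex valued. -/
noncomputable def gumF (k : ℕ) (t : ℝ) : ℂ := (((Real.log t) ^ k * Real.exp (-t) : ℝ) : ℂ)

/-- The `k`-th derivative of the Gamma integral. -/
noncomputable def gumG (k : ℕ) (s : ℂ) : ℂ := mellin (gumF k) s

lemma gumF_succ (k : ℕ) : gumF (k + 1) = fun t => Real.log t • gumF k t := by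
  funext t
  simp only [gumF, Complex.real_smul]
  push_cast
  ring

open Asymptotics Filter Topology Set in
lemma gumF_top (k : ℕ) : ∀ a : ℝ, gumF k =O[atTop] (fun t : ℝ => t ^ (-a)) := by
  induction k with
  | zero =>
    intro a
    rw [← isBigO_norm_left]
    simp only [gumF, pow_zero, one_mul]
    simp_rw [Complex.norm_real, isBigO_norm_left]
    simpa only [neg_one_mul] using (isLittleO_exp_neg_mul_rpow_atTop zero_lt_one _).isBigO
  | succ k ih =>
    intro a
    rw [gumF_succ]
    exact isBigO_rpow_top_log_smul (lt_add_one a) (ih _)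

open Asymptotics Filter Topology Set in
lemma gumF_bot (k : ℕ) : ∀ b : ℝ, 0 < b → gumF k =O[𝓝[>] 0] (fun t : ℝ => t ^ (-b)) := by
  induction k with
  | zero =>
    intro b hb
    have h0 : gumF 0 =O[𝓝[>] 0] (fun t : ℝ => t ^ (-(0:ℝ))) := by
      simp_rw [neg_zero, rpow_zero]
      refine isBigO_const_of_tendsto (?_ : Tendsto _ _ (𝓝 (1 : ℂ))) one_ne_zero
      have : gumF 0 = fun t : ℝ => ((Real.exp (-t) : ℝ) : ℂ) := by
        funext t; simp [gumF]
      rw [this, (by simp : (1 : ℂ) = Real.exp (-0))]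
      exact (Complex.continuous_ofReal.comp
        (Real.continuous_exp.comp continuous_neg)).continuousWithinAt
    refine h0.trans ?_
    simp_rw [neg_zero, rpow_zero]
    refine IsBigO.of_bound 1 ?_
    filter_upwards [Ioo_mem_nhdsGT (zero_lt_one : (0:ℝ) < 1)] with t ht
    have : 1 ≤ t ^ (-b) := one_le_rpow_of_pos_of_le_one_of_nonpos ht.1 ht.2.le (by linarith)
    rw [norm_one, one_mul, Real.norm_eq_abs]
    exact this.trans (le_abs_self _)
  | succ k ih =>
    intro b hb
    rw [gumF_succ]
    exact isBigO_rpow_zero_log_smul (half_lt_self hb) (ih _ (half_pos hb))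

open Set in
lemma gumF_loc (k : ℕ) : LocallyIntegrableOn (gumF k) (Ioi 0) := by
  refine ContinuousOn.locallyIntegrableOn ?_ measurableSet_Ioi
  unfold gumF
  refine Complex.continuous_ofReal.comp_continuousOn ?_
  refine ContinuousOn.mul (ContinuousOn.pow (Real.continuousOn_log.mono ?_) _) (by fun_prop)
  intro t ht
  exact (ne_of_gt ht)

lemma gumF_conv (k : ℕ) {s : ℂ} (hs : 0 < s.re) : MellinConvergent (gumF k) s :=
  mellinConvergent_of_isBigO_rpow (gumF_loc k) (gumF_top k (s.re + 1)) (by linarith)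
    (gumF_bot k (s.re / 2) (by linarith)) (by linarith)

lemma gumG_deriv (k : ℕ) {s : ℂ} (hs : 0 < s.re) :
    HasDerivAt (gumG k) (gumG (k + 1) s) s := by
  have := (mellin_hasDerivAt_of_isBigO_rpow (gumF_loc k) (gumF_top k (s.re + 1)) (by linarith)
    (gumF_bot k (s.re / 2) (by linarith)) (by linarith) : _ ∧ HasDerivAt _ _ s).2
  rw [← gumF_succ] at this
  exact this

lemma gumG_zero {s : ℂ} (hs : 0 < s.re) : gumG 0 s = Complex.Gamma s := by
  rw [Complex.Gamma_eq_integral hs, Complex.GammaIntegral_eq_mellin]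
  simp [gumG, gumF, mellin]

lemma gum_deriv_congr {U : Set ℂ} (hU : IsOpen U) {f g f' g' : ℂ → ℂ}
    (h : ∀ s ∈ U, f s = g s) (hf : ∀ s ∈ U, HasDerivAt f (f' s) s)
    (hg : ∀ s ∈ U, HasDerivAt g (g' s) s) : ∀ s ∈ U, f' s = g' s := by
  intro s hs
  have : f =ᶠ[nhds s] g := Filter.eventuallyEq_of_mem (hU.mem_nhds hs) h
  exact (hf s hs).unique ((hg s hs).congr_of_eventuallyEq this)

lemma gum_isOpen : IsOpen {s : ℂ | 0 < s.re} := isOpen_lt continuous_const Complex.continuous_re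

lemma gumG_rec0 : ∀ s ∈ {s : ℂ | 0 < s.re}, gumG 0 (s + 1) = s * gumG 0 s := by
  intro s hs
  have hs' : 0 < s.re := hs
  rw [gumG_zero hs', gumG_zero (by simp; linarith), Complex.Gamma_add_one]
  rintro rfl
  simp at hs'

lemma gumG_shift (k : ℕ) : ∀ s ∈ {s : ℂ | 0 < s.re},
    HasDerivAt (fun s => gumG k (s + 1)) (gumG (k + 1) (s + 1)) s := by
  intro s hs
  have hs' : 0 < s.re := hs
  exact (gumG_deriv k (s := s + 1) (by simp; linarith)).comp_add_const s 1

lemma gumG_rec1 : ∀ s ∈ {s : ℂ | 0 < s.re},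
    gumG 1 (s + 1) = gumG 0 s + s * gumG 1 s := by
  refine gum_deriv_congr gum_isOpen gumG_rec0 (gumG_shift 0) ?_
  intro s hs
  exact ((hasDerivAt_id s).mul (gumG_deriv 0 hs)).congr_deriv (by simp)

lemma gumG_rec2 : ∀ s ∈ {s : ℂ | 0 < s.re},
    gumG 2 (s + 1) = 2 * gumG 1 s + s * gumG 2 s := by
  refine gum_deriv_congr gum_isOpen gumG_rec1 (gumG_shift 1) ?_
  intro s hs
  exact ((gumG_deriv 0 hs).add ((hasDerivAt_id s).mul (gumG_deriv 1 hs))).congr_deriv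
    (by simp; ring)

lemma gumG_zero_one : gumG 0 1 = 1 := by
  rw [gumG_zero (by simp), Complex.Gamma_one]

lemma gumG_one_one : gumG 1 1 = -(Real.eulerMascheroniConstant : ℂ) := by
  have h1 : HasDerivAt (gumG 0) (gumG 1 1) 1 := gumG_deriv 0 (by simp)
  refine h1.unique (Complex.hasDerivAt_Gamma_one.congr_of_eventuallyEq ?_)
  filter_upwards [gum_isOpen.mem_nhds (show (1:ℂ) ∈ {s : ℂ | 0 < s.re} by simp)] with s hs
  exact gumG_zero hs

lemma gum_reflect : ∀ s ∈ Metric.ball (0:ℂ) 1,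
    Complex.sin (π * s) * (gumG 0 (1 + s) * gumG 0 (1 - s)) = π * s := by
  intro s hs
  have hn : ‖s‖ < 1 := by simpa using hs
  have hre := abs_lt.1 ((Complex.abs_re_le_norm s).trans_lt hn)
  rw [gumG_zero (by simp; linarith), gumG_zero (by simp; linarith)]
  by_cases h0 : s = 0
  · simp [h0]
  rw [add_comm, Complex.Gamma_add_one _ h0, mul_assoc, Complex.Gamma_mul_Gamma_one_sub]
  have hsin : Complex.sin (π * s) ≠ 0 := by
    rw [Complex.sin_ne_zero_iff]
    intro k hk
    have hpi : (π : ℂ) ≠ 0 := by exact_mod_cast Real.pi_ne_zero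
    have hk' : s = k := by
      rw [mul_comm] at hk
      exact mul_right_cancel₀ hpi hk
    rw [hk'] at hn h0
    rw [Complex.norm_intCast] at hn
    have : |k| < 1 := by exact_mod_cast hn
    apply h0
    rw [Int.abs_lt_one_iff.1 this]
    simp
  field_simp

lemma gumG_plus (k : ℕ) : ∀ s ∈ Metric.ball (0:ℂ) 1,
    HasDerivAt (fun s => gumG k (1 + s)) (gumG (k + 1) (1 + s)) s := by
  intro s hs
  have hn : ‖s‖ < 1 := by simpa using hs
  have hre := abs_lt.1 ((Complex.abs_re_le_norm s).trans_lt hn)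
  exact (gumG_deriv k (s := 1 + s) (by simp; linarith)).comp_const_add 1 s

lemma gumG_minus (k : ℕ) : ∀ s ∈ Metric.ball (0:ℂ) 1,
    HasDerivAt (fun s => gumG k (1 - s)) (-gumG (k + 1) (1 - s)) s := by
  intro s hs
  have hn : ‖s‖ < 1 := by simpa using hs
  have hre := abs_lt.1 ((Complex.abs_re_le_norm s).trans_lt hn)
  exact (gumG_deriv k (s := 1 - s) (by simp; linarith)).comp_const_sub 1 s

lemma gum_sin (s : ℂ) : HasDerivAt (fun s : ℂ => Complex.sin (π * s))
    (π * Complex.cos (π * s)) s := by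
  have := (((hasDerivAt_id s).const_mul (π : ℂ))).csin
  simpa [mul_comm] using this

lemma gum_cos (s : ℂ) : HasDerivAt (fun s : ℂ => Complex.cos (π * s))
    (-(π * Complex.sin (π * s))) s := by
  have := (((hasDerivAt_id s).const_mul (π : ℂ))).ccos
  simpa [mul_comm] using this

/-- products of the derivatives at `1+s` and `1-s` -/
noncomputable def gumP (i j : ℕ) (s : ℂ) : ℂ := gumG i (1 + s) * gumG j (1 - s)

lemma gumP_deriv (i j : ℕ) : ∀ s ∈ Metric.ball (0:ℂ) 1,
    HasDerivAt (gumP i j) (gumP (i + 1) j s - gumP i (j + 1) s) s := by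
  intro s hs
  exact ((gumG_plus i s hs).mul (gumG_minus j s hs)).congr_deriv (by simp only [gumP]; ring)

lemma gum_second : gumG 2 1 = (π : ℂ) ^ 2 / 6 + (Real.eulerMascheroniConstant : ℂ) ^ 2 := by
  have e1 := gum_deriv_congr (f' := fun s => π * Complex.cos (π * s) * gumP 0 0 s +
      Complex.sin (π * s) * (gumP 1 0 s - gumP 0 1 s)) (g' := fun _ => (π : ℂ))
      Metric.isOpen_ball gum_reflect
      (fun s hs => (gum_sin s).mul (gumP_deriv 0 0 s hs))
      (fun s hs => by simpa using (hasDerivAt_id s).const_mul (π : ℂ))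
  have e2 := gum_deriv_congr (f' := fun s =>
      (π * -(π * Complex.sin (π * s))) * gumP 0 0 s +
        (π * Complex.cos (π * s)) * (gumP 1 0 s - gumP 0 1 s) +
      (π * Complex.cos (π * s) * (gumP 1 0 s - gumP 0 1 s) +
        Complex.sin (π * s) * ((gumP 2 0 s - gumP 1 1 s) - (gumP 1 1 s - gumP 0 2 s))))
      (g' := fun _ => (0 : ℂ))
      Metric.isOpen_ball e1
      (fun s hs => (((gum_cos s).const_mul (π : ℂ)).mul (gumP_deriv 0 0 s hs)).add
        ((gum_sin s).mul ((gumP_deriv 1 0 s hs).sub (gumP_deriv 0 1 s hs))))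
      (fun s hs => hasDerivAt_const s _)
  have h0 : (0:ℂ) ∈ Metric.ball (0:ℂ) 1 := by simp
  have d3 := ((((gum_sin 0).const_mul (π : ℂ)).neg.const_mul (π : ℂ)).mul
    (gumP_deriv 0 0 0 h0)).add (((gum_cos 0).const_mul (π : ℂ)).mul
      ((gumP_deriv 1 0 0 h0).sub (gumP_deriv 0 1 0 h0))) |>.add
    ((((gum_cos 0).const_mul (π : ℂ)).mul
      ((gumP_deriv 1 0 0 h0).sub (gumP_deriv 0 1 0 h0))).add
     ((gum_sin 0).mul (((gumP_deriv 2 0 0 h0).sub (gumP_deriv 1 1 0 h0)).sub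
      ((gumP_deriv 1 1 0 h0).sub (gumP_deriv 0 2 0 h0)))))
  have e3 := d3.unique ((hasDerivAt_const (0:ℂ) (0:ℂ)).congr_of_eventuallyEq
    (Filter.eventuallyEq_of_mem (Metric.isOpen_ball.mem_nhds h0) e2))
  simp [gumP, gumG_zero_one, gumG_one_one] at e3
  have hpi : (π : ℂ) ≠ 0 := by exact_mod_cast Real.pi_ne_zero
  apply mul_left_cancel₀ hpi
  linear_combination e3 / 6

/-- real moments -/
lemma gum_moment_int (k n : ℕ) :
    IntegrableOn (fun t : ℝ => t ^ n * ((Real.log t) ^ k * Real.exp (-t))) (Set.Ioi 0) := by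
  have h := gumF_conv k (s := (n : ℂ) + 1) (by simp; positivity)
  have h2 := MeasureTheory.Integrable.re h
  refine h2.congr (Filter.Eventually.of_forall fun t => ?_)
  simp only [gumF, add_sub_cancel_right, Complex.cpow_natCast, smul_eq_mul]
  rw [← Complex.ofReal_pow, ← Complex.ofReal_mul]
  exact Complex.ofReal_re _

lemma gum_moment (k n : ℕ) :
    ((∫ t in Set.Ioi (0:ℝ), t ^ n * ((Real.log t) ^ k * Real.exp (-t)) : ℝ) : ℂ)
      = gumG k (n + 1) := by
  rw [← integral_complex_ofReal]
  unfold gumG mellin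
  congr 1
  funext t
  simp [gumF]

lemma gum_integral :
    ∫ t in Set.Ioi (0:ℝ), (-Real.log t * (1 - t) - 1) ^ 2 * Real.exp (-t)
      = π ^ 2 / 6 + eulerMascheroniConstant ^ 2 - 2 * eulerMascheroniConstant + 1 := by
  set M : ℕ → ℕ → ℝ → ℝ := fun k n t => t ^ n * ((Real.log t) ^ k * Real.exp (-t)) with hM
  have hi : ∀ k n, Integrable (M k n) (volume.restrict (Set.Ioi (0:ℝ))) := gum_moment_int
  have e : ∀ t, (-Real.log t * (1 - t) - 1) ^ 2 * Real.exp (-t) =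
      M 0 0 t + 2 * M 1 0 t - 2 * M 1 1 t + M 2 0 t - 2 * M 2 1 t + M 2 2 t := by
    intro t
    simp only [hM]
    ring
  simp_rw [e]
  rw [integral_add (by fun_prop) (by fun_prop), integral_sub (by fun_prop) (by fun_prop),
    integral_add (by fun_prop) (by fun_prop), integral_sub (by fun_prop) (by fun_prop),
    integral_add (by fun_prop) (by fun_prop), integral_const_mul, integral_const_mul,
    integral_const_mul]
  have r1 := gumG_rec1 1 (by simp)
  have r2 := gumG_rec2 1 (by simp)
  have r3 := gumG_rec2 (1 + 1) (by simp)
  have m00 := gum_moment 0 0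
  have m10 := gum_moment 1 0
  have m11 := gum_moment 1 1
  have m20 := gum_moment 2 0
  have m21 := gum_moment 2 1
  have m22 := gum_moment 2 2
  simp only [Nat.cast_zero, zero_add, Nat.cast_one] at m00 m10 m11 m20 m21 m22
  rw [show ((2:ℕ):ℂ) + 1 = 1 + 1 + 1 by norm_num, r3, r2, r1, gum_second, gumG_zero_one,
    gumG_one_one] at m22
  rw [r2, gum_second, gumG_one_one] at m21
  rw [gum_second] at m20
  rw [r1, gumG_zero_one, gumG_one_one] at m11
  rw [gumG_one_one] at m10
  rw [gumG_zero_one] at m00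
  norm_cast at m00 m10 m11 m20 m21 m22
  simp only [hM]
  rw [m00, m10, m11, m20, m21, m22]
  push_cast
  ring

lemma gum_sub (g : ℝ → ℝ) :
    ∫ x : ℝ, Real.exp (-x) * g (Real.exp (-x)) = ∫ t in Set.Ioi (0:ℝ), g t := by
  have himg : (fun x : ℝ => Real.exp (-x)) '' Set.univ = Set.Ioi 0 := by
    ext t
    simp only [Set.image_univ, Set.mem_range, Set.mem_Ioi]
    constructor
    · rintro ⟨x, rfl⟩
      exact Real.exp_pos _
    · intro ht
      exact ⟨-Real.log t, by simp [Real.exp_log ht]⟩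
  have h := integral_image_eq_integral_abs_deriv_smul (s := Set.univ)
    (f := fun x : ℝ => Real.exp (-x)) (f' := fun x => -Real.exp (-x)) MeasurableSet.univ
    (fun x _ => by
      have := ((hasDerivAt_id x).neg).exp
      exact HasDerivAt.hasDerivWithinAt (by simpa using this))
    (fun x _ y _ hxy => by simpa using hxy) g
  rw [himg] at h
  rw [h]
  simp [abs_neg, Real.abs_exp]

theorem gumbel_fisher_sigma_sigma (μ σ : ℝ) (hσ : 0 < σ) :
    ∫ x : ℝ, (gumbelScoreSigma μ σ x) ^ 2 * gumbelPdf μ σ x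
      = (Real.pi ^ 2 / 6 + Real.eulerMascheroniConstant ^ 2
          - 2 * Real.eulerMascheroniConstant + 1) / σ ^ 2 := by
  have e : ∀ x, (gumbelScoreSigma μ σ x) ^ 2 * gumbelPdf μ σ x =
      (fun y => (fun z => (1 / σ ^ 3) * (Real.exp (-z) *
        (fun t => (-Real.log t * (1 - t) - 1) ^ 2 * Real.exp (-t)) (Real.exp (-z)))) (y / σ))
        (x - μ) := by
    intro x
    simp only [gumbelScoreSigma, gumbelPdf, Real.log_exp]
    field_simp
    try ring
  simp_rw [e]
  rw [integral_sub_right_eq_self (fun y => (fun z => (1 / σ ^ 3) * (Real.exp (-z) *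
        (fun t => (-Real.log t * (1 - t) - 1) ^ 2 * Real.exp (-t)) (Real.exp (-z)))) (y / σ)) μ,
    Measure.integral_comp_div (fun z => (1 / σ ^ 3) * (Real.exp (-z) *
        (fun t => (-Real.log t * (1 - t) - 1) ^ 2 * Real.exp (-t)) (Real.exp (-z)))) σ,
    integral_const_mul, gum_sub (fun t => (-Real.log t * (1 - t) - 1) ^ 2 * Real.exp (-t)), gum_integral, abs_of_pos hσ,
    smul_eq_mul]
  field_simp
end

section
/- (Orthogonality of the Gumbel reparametrisation with transformed scale parameter σ̃(μ,ρ) = ((1−γ)/(π²/6 + γ² − 2γ + 1))·μ + C₂(ρ).) For all μ ∈ ℝ and σ > 0, ∫_ℝ (s_μ(x;μ,σ) + a·s_σ(x;μ,σ)) · s_σ(x;μ,σ) · f(x;μ,σ) dx = 0, where a = (1−γ)/(π²/6 + γ² − 2γ + 1) and γ is the Euler–Mascheroni constant. Equivalently, the Fisher cross-information between the new parameters μ and ρ vanishes, since the score in ρ is C₂'(ρ)·s_σ and the score in μ under the reparametrisation is s_μ + a·s_σ by the chain rule. -/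
open MeasureTheory Real

/-- Score of the Gumbel distribution with respect to the location parameter μ. -/
noncomputable def gumbelScoreMu (μ σ x : ℝ) : ℝ :=
  (1 / σ) * (1 - Real.exp (-((x - μ) / σ)))

namespace GumbelAux

open Set Filter Topology Asymptotics

/-- `exp (-t)` as a complex valued function. -/
noncomputable def f0 (t : ℝ) : ℂ := ((Real.exp (-t) : ℝ) : ℂ)

/-- `log t * exp (-t)`. -/
noncomputable def f1 (t : ℝ) : ℂ := Real.log t • f0 t

/-- `log t ^ 2 * exp (-t)`. -/
noncomputable def f2 (t : ℝ) : ℂ := Real.log t • f1 t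

lemma f0_cont : Continuous f0 := by
  unfold f0; fun_prop

lemma f0_top (a : ℝ) : f0 =O[atTop] (fun t : ℝ => t ^ (-a)) := by
  unfold f0
  rw [← isBigO_norm_left]
  simp_rw [Complex.norm_real, isBigO_norm_left]
  simpa only [neg_one_mul] using (isLittleO_exp_neg_mul_rpow_atTop zero_lt_one _).isBigO

lemma f0_bot1 : f0 =O[𝓝[>] 0] (fun _ : ℝ => (1 : ℝ)) := by
  refine isBigO_const_of_tendsto (?_ : Tendsto _ _ (𝓝 (f0 0))) one_ne_zero
  exact f0_cont.continuousWithinAt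

lemma f0_bot : f0 =O[𝓝[>] 0] (fun t : ℝ => t ^ (-(0 : ℝ))) := by
  simpa using f0_bot1

lemma f1_cont : ContinuousOn f1 (Ioi 0) := by
  unfold f1
  exact ContinuousOn.smul (Real.continuousOn_log.mono (fun x hx => ne_of_gt hx)) f0_cont.continuousOn

lemma f1_top (a : ℝ) : f1 =O[atTop] (fun t : ℝ => t ^ (-a)) := by
  have h := (isLittleO_log_rpow_atTop (zero_lt_one)).isBigO.smul (f0_top (a + 1))
  refine h.congr' (EventuallyEq.refl _ _) ?_
  filter_upwards [eventually_gt_atTop 0] with t ht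
  rw [smul_eq_mul, ← Real.rpow_add ht]
  congr 1; ring

lemma f1_bot {b : ℝ} (hb : 0 < b) : f1 =O[𝓝[>] 0] (fun t : ℝ => t ^ (-b)) := by
  have h := (isLittleO_log_rpow_nhdsGT_zero (neg_lt_zero.mpr hb)).isBigO.smul f0_bot1
  refine h.congr' (EventuallyEq.refl _ _) (Eventually.of_forall fun t => ?_)
  simp

lemma mellin0 {s : ℂ} (hs : 0 < s.re) : MellinConvergent f0 s :=
  mellinConvergent_of_isBigO_rpow (f0_cont.continuousOn.locallyIntegrableOn measurableSet_Ioi)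
    (f0_top (s.re + 1)) (lt_add_one _) f0_bot hs

lemma mellin1 {s : ℂ} (hs : 0 < s.re) :
    MellinConvergent f1 s ∧ HasDerivAt (mellin f0) (mellin f1 s) s :=
  mellin_hasDerivAt_of_isBigO_rpow (f0_cont.continuousOn.locallyIntegrableOn measurableSet_Ioi)
    (f0_top (s.re + 1)) (lt_add_one _) f0_bot hs

lemma mellin2 {s : ℂ} (hs : 0 < s.re) :
    MellinConvergent f2 s ∧ HasDerivAt (mellin f1) (mellin f2 s) s :=
  mellin_hasDerivAt_of_isBigO_rpow (f1_cont.locallyIntegrableOn measurableSet_Ioi)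
    (f1_top (s.re + 1)) (lt_add_one _) (f1_bot (half_pos hs)) (half_lt_self hs)

lemma mellin_f0 {s : ℂ} (hs : 0 < s.re) : mellin f0 s = Complex.Gamma s := by
  rw [Complex.Gamma_eq_integral hs, Complex.GammaIntegral_eq_mellin]; rfl

lemma ev_re {s : ℂ} (hs : 0 < s.re) : ∀ᶠ z in 𝓝 s, 0 < z.re :=
  (isOpen_lt continuous_const Complex.continuous_re).mem_nhds hs

lemma G_deriv {s : ℂ} (hs : 0 < s.re) : HasDerivAt Complex.Gamma (mellin f1 s) s :=
  (mellin1 hs).2.congr_of_eventuallyEq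
    ((ev_re hs).mono fun _ hz => (mellin_f0 hz).symm)

lemma f1_one : mellin f1 1 = -(Real.eulerMascheroniConstant : ℂ) :=
  (G_deriv (by simp)).unique Complex.hasDerivAt_Gamma_one

lemma f1_add {s : ℂ} (hs : 0 < s.re) :
    mellin f1 (s + 1) = Complex.Gamma s + s * mellin f1 s := by
  have h1 : HasDerivAt (fun z => Complex.Gamma (z + 1)) (mellin f1 (s + 1)) s :=
    (G_deriv (s := s + 1) (by simp; linarith)).comp_add_const s 1
  have h2 := (hasDerivAt_id s).mul (G_deriv hs)
  have h3 := h2.congr_of_eventuallyEq (f₁ := fun z => Complex.Gamma (z + 1))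
    ((ev_re hs).mono fun z hz => Complex.Gamma_add_one z (by rintro rfl; simp at hz))
  have := h1.unique h3
  simpa using this

lemma f2_add {s : ℂ} (hs : 0 < s.re) :
    mellin f2 (s + 1) = 2 * mellin f1 s + s * mellin f2 s := by
  have h1 : HasDerivAt (fun z => mellin f1 (z + 1)) (mellin f2 (s + 1)) s :=
    (mellin2 (s := s + 1) (by simp; linarith)).2.comp_add_const s 1
  have h2 := (G_deriv hs).add ((hasDerivAt_id s).mul (mellin2 hs).2)
  have h3 := h2.congr_of_eventuallyEq (f₁ := fun z => mellin f1 (z + 1))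
    ((ev_re hs).mono fun z hz => f1_add hz)
  have := h1.unique h3
  rw [this]; simp; ring

lemma refl_formula {z : ℂ} (hz : |z.re| < 1) :
    Complex.Gamma (1 + z) * Complex.Gamma (1 - z) * Complex.sin (π * z) = π * z := by
  by_cases h0 : z = 0
  · simp [h0]
  have hs : Complex.sin (π * z) ≠ 0 := by
    rw [Complex.sin_ne_zero_iff]
    intro k hk
    have hpi : (π : ℂ) ≠ 0 := by exact_mod_cast Real.pi_ne_zero
    have hzk : z = k := by
      apply mul_left_cancel₀ hpi; rw [hk]; ring
    rw [hzk] at hz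
    simp only [Complex.intCast_re] at hz
    have : |k| < 1 := by exact_mod_cast hz
    have hk0 : k = 0 := Int.abs_lt_one_iff.mp this
    exact h0 (by simp [hzk, hk0])
  rw [add_comm, Complex.Gamma_add_one z h0, mul_assoc z, Complex.Gamma_mul_Gamma_one_sub,
    mul_assoc, div_mul_cancel₀ _ hs, mul_comm]

lemma f2_one : mellin f2 1 = (Real.eulerMascheroniConstant : ℂ) ^ 2 + (π : ℂ) ^ 2 / 6 := by
  have hpi : (π : ℂ) ≠ 0 := by exact_mod_cast Real.pi_ne_zero
  have hev : ∀ᶠ z : ℂ in 𝓝 0, |z.re| < 1 :=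
    (isOpen_lt (Complex.continuous_re.abs) continuous_const).mem_nhds (by simp)
  have hp : ∀ {z : ℂ}, |z.re| < 1 → 0 < (1 + z).re := by
    intro z hz; simp; linarith [(abs_lt.mp hz).1]
  have hm : ∀ {z : ℂ}, |z.re| < 1 → 0 < (1 - z).re := by
    intro z hz; simp; linarith [(abs_lt.mp hz).2]
  let G := Complex.Gamma
  let A := mellin f1
  let B := mellin f2
  let H : ℂ → ℂ := fun z => G (1 + z) * G (1 - z)
  let H1 : ℂ → ℂ := fun z => A (1 + z) * G (1 - z) - G (1 + z) * A (1 - z)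
  let H2 : ℂ → ℂ := fun z => B (1 + z) * G (1 - z) - 2 * (A (1 + z) * A (1 - z))
    + G (1 + z) * B (1 - z)
  have dH : ∀ z : ℂ, |z.re| < 1 → HasDerivAt H (H1 z) z := by
    intro z hz
    have := ((G_deriv (hp hz)).comp_const_add 1 z).mul ((G_deriv (hm hz)).comp_const_sub 1 z)
    refine this.congr_deriv ?_
    simp only [H1, A, G]; ring
  have dH1 : ∀ z : ℂ, |z.re| < 1 → HasDerivAt H1 (H2 z) z := by
    intro z hz
    have e1 := ((mellin2 (hp hz)).2.comp_const_add 1 z).mul ((G_deriv (hm hz)).comp_const_sub 1 z)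
    have e2 := ((G_deriv (hp hz)).comp_const_add 1 z).mul ((mellin2 (hm hz)).2.comp_const_sub 1 z)
    refine (e1.sub e2).congr_deriv ?_
    simp only [H2, A, B, G]; ring
  have dS : ∀ z : ℂ, HasDerivAt (fun z : ℂ => Complex.sin (π * z)) (π * Complex.cos (π * z)) z := by
    intro z
    have := ((hasDerivAt_id z).const_mul (π : ℂ)).csin
    refine this.congr_deriv ?_
    simp; ring
  have dC : ∀ z : ℂ, HasDerivAt (fun z : ℂ => Complex.cos (π * z)) (-(π * Complex.sin (π * z))) z := by
    intro z
    have := ((hasDerivAt_id z).const_mul (π : ℂ)).ccos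
    refine this.congr_deriv ?_
    simp; ring
  have evz : ∀ z : ℂ, |z.re| < 1 → ∀ᶠ w : ℂ in 𝓝 z, |w.re| < 1 := fun z hz =>
    (isOpen_lt (Complex.continuous_re.abs) continuous_const).mem_nhds hz
  -- first derivative of the reflection identity
  have k1 : ∀ z : ℂ, |z.re| < 1 →
      H1 z * Complex.sin (π * z) + H z * (π * Complex.cos (π * z)) = π := by
    intro z hz
    have e1 := (dH z hz).mul (dS z)
    have e2 : HasDerivAt (fun z : ℂ => (π : ℂ) * z) π z := by
      simpa using (hasDerivAt_id z).const_mul (π : ℂ)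
    exact e1.unique (e2.congr_of_eventuallyEq ((evz z hz).mono fun w hw => refl_formula hw))
  have k2 : ∀ z : ℂ, |z.re| < 1 →
      H2 z * Complex.sin (π * z) + 2 * π * (H1 z * Complex.cos (π * z))
        - π ^ 2 * (H z * Complex.sin (π * z)) = 0 := by
    intro z hz
    have e1 := ((dH1 z hz).mul (dS z)).add ((dH z hz).mul ((dC z).const_mul (π : ℂ)))
    have e2 := e1.unique ((hasDerivAt_const z (π : ℂ)).congr_of_eventuallyEq
      ((evz z hz).mono fun w hw => k1 w hw))
    linear_combination e2
  have h00 : |(0 : ℂ).re| < 1 := by simp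
  -- differentiability of `B` at `1`
  have hB : DifferentiableAt ℂ B 1 := by
    have hd : DifferentiableOn ℂ A {z : ℂ | 0 < z.re} := fun z hz =>
      (mellin2 hz).2.differentiableAt.differentiableWithinAt
    have ho : IsOpen {z : ℂ | 0 < z.re} := isOpen_lt continuous_const Complex.continuous_re
    have h1 : (1 : ℂ) ∈ {z : ℂ | 0 < z.re} := by simp
    have hd2 := (hd.deriv ho).differentiableAt (ho.mem_nhds h1)
    refine hd2.congr_of_eventuallyEq ?_
    filter_upwards [ho.mem_nhds h1] with z hz
    exact (mellin2 hz).2.deriv.symm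
  have hB1 : HasDerivAt B (deriv B 1) 1 := hB.hasDerivAt
  obtain ⟨d, dH2⟩ : ∃ d, HasDerivAt H2 d 0 := by
    have b1 : HasDerivAt (fun z => B (1 + z)) (deriv B 1) 0 :=
      HasDerivAt.comp_const_add 1 0 (by simpa using hB1)
    have b2 : HasDerivAt (fun z => B (1 - z)) (-deriv B 1) 0 :=
      HasDerivAt.comp_const_sub 1 0 (by simpa using hB1)
    have a1 := (mellin2 (hp h00)).2.comp_const_add 1 0
    have a2 := (mellin2 (hm h00)).2.comp_const_sub 1 0
    have g1 := (G_deriv (hp h00)).comp_const_add 1 0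
    have g2 := (G_deriv (hm h00)).comp_const_sub 1 0
    exact ⟨_, ((b1.mul g2).sub ((a1.mul a2).const_mul 2)).add (g1.mul b2)⟩
  have e1 := ((dH2.mul (dS 0)).add (((dH1 0 h00).mul (dC 0)).const_mul (2 * (π : ℂ)))).sub
    (((dH 0 h00).mul (dS 0)).const_mul ((π : ℂ) ^ 2))
  have e2 := e1.unique ((hasDerivAt_const (0 : ℂ) (0 : ℂ)).congr_of_eventuallyEq
      (hev.mono fun w hw => k2 w hw))
  simp [H2, H1, H, A, B, G, f1_one] at e2
  have : (π : ℂ) * (6 * mellin f2 1 - 6 * (Real.eulerMascheroniConstant : ℂ) ^ 2 - π ^ 2) = 0 := by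
    linear_combination e2
  have := (mul_eq_zero.mp this).resolve_left hpi
  linear_combination this / 6

/-- `h` is integrable on `(0, ∞)` with integral `v`. -/
def HI (h : ℝ → ℝ) (v : ℝ) : Prop := IntegrableOn h (Ioi 0) ∧ ∫ t in Ioi 0, h t = v

lemma HI.add {h k : ℝ → ℝ} {v w : ℝ} (hh : HI h v) (hk : HI k w) :
    HI (fun t => h t + k t) (v + w) :=
  ⟨hh.1.add hk.1, by rw [integral_add hh.1 hk.1, hh.2, hk.2]⟩

lemma HI.smul {h : ℝ → ℝ} {v : ℝ} (c : ℝ) (hh : HI h v) : HI (fun t => c * h t) (c * v) :=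
  ⟨hh.1.const_mul c, by rw [integral_const_mul, hh.2]⟩

lemma HI.of_mellin {F : ℝ → ℂ} {h : ℝ → ℝ} (hF : ∀ t, F t = (h t : ℂ)) (n : ℕ) {s : ℂ}
    (hs : s = n + 1) (hc : MellinConvergent F s) {v : ℝ} (hv : mellin F s = (v : ℂ)) :
    HI (fun t => t ^ n * h t) v := by
  have key : (fun t : ℝ => (t : ℂ) ^ (s - 1) • F t) = fun t => ((t ^ n * h t : ℝ) : ℂ) := by
    funext t
    rw [hF, hs]; simp
  unfold MellinConvergent at hc
  unfold mellin at hv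
  rw [key] at hc hv
  constructor
  · have := hc.re
    simp only [RCLike.re_to_complex, Complex.ofReal_re] at this
    exact this
  · rw [integral_complex_ofReal] at hv
    exact_mod_cast hv

lemma f0_eq (t : ℝ) : f0 t = ((Real.exp (-t) : ℝ) : ℂ) := rfl
lemma f1_eq (t : ℝ) : f1 t = ((Real.log t * Real.exp (-t) : ℝ) : ℂ) := by simp [f1, f0]
lemma f2_eq (t : ℝ) : f2 t = ((Real.log t ^ 2 * Real.exp (-t) : ℝ) : ℂ) := by
  simp [f2, f1, f0]; ring

local notation "γ" => Real.eulerMascheroniConstant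

lemma f1_two : mellin f1 2 = 1 - (γ : ℂ) := by
  have := f1_add (s := 1) (by simp)
  rw [f1_one, one_add_one_eq_two] at this
  rw [this]; simp; ring

lemma f1_three : mellin f1 3 = 3 - 2 * (γ : ℂ) := by
  have := f1_add (s := 2) (by simp)
  rw [f1_two, show (2 : ℂ) + 1 = 3 by norm_num] at this
  rw [this, Complex.Gamma_ofNat_eq_factorial]; simp; ring

lemma f2_two : mellin f2 2 = (γ : ℂ) ^ 2 + (π : ℂ) ^ 2 / 6 - 2 * γ := by
  have := f2_add (s := 1) (by simp)
  rw [f1_one, f2_one, one_add_one_eq_two] at this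
  rw [this]; ring

lemma f2_three : mellin f2 3 = 2 * ((γ : ℂ) ^ 2 + (π : ℂ) ^ 2 / 6) + 2 - 6 * γ := by
  have := f2_add (s := 2) (by simp)
  rw [f1_two, f2_two, show (2 : ℂ) + 1 = 3 by norm_num] at this
  rw [this]; ring

lemma main_HI (a : ℝ) : HI (fun t => ((1 - t) + a * (-Real.log t * (1 - t) - 1)) *
      (-Real.log t * (1 - t) - 1) * Real.exp (-t))
    (-(1 - γ) + a * (π ^ 2 / 6 + γ ^ 2 - 2 * γ + 1)) := by
  have z0 := HI.of_mellin f0_eq 0 (s := 1) (by simp) (mellin0 (by simp)) (v := 1)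
    (by rw [mellin_f0 (by simp)]; simp)
  have z1 := HI.of_mellin f0_eq 1 (s := 2) (by norm_num) (mellin0 (by simp)) (v := 1)
    (by rw [mellin_f0 (by simp), Complex.Gamma_ofNat_eq_factorial]; simp)
  have o0 := HI.of_mellin f1_eq 0 (s := 1) (by simp) (mellin1 (by simp)).1 (v := -γ)
    (by rw [f1_one]; push_cast; ring)
  have o1 := HI.of_mellin f1_eq 1 (s := 2) (by norm_num) (mellin1 (by simp)).1 (v := 1 - γ)
    (by rw [f1_two]; push_cast; ring)
  have o2 := HI.of_mellin f1_eq 2 (s := 3) (by norm_num) (mellin1 (by simp)).1 (v := 3 - 2 * γ)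
    (by rw [f1_three]; push_cast; ring)
  have t0 := HI.of_mellin f2_eq 0 (s := 1) (by simp) (mellin2 (by simp)).1 (v := γ ^ 2 + π ^ 2 / 6)
    (by rw [f2_one]; push_cast; ring)
  have t1 := HI.of_mellin f2_eq 1 (s := 2) (by norm_num) (mellin2 (by simp)).1
    (v := γ ^ 2 + π ^ 2 / 6 - 2 * γ) (by rw [f2_two]; push_cast; ring)
  have t2 := HI.of_mellin f2_eq 2 (s := 3) (by norm_num) (mellin2 (by simp)).1
    (v := 2 * (γ ^ 2 + π ^ 2 / 6) + 2 - 6 * γ) (by rw [f2_three]; push_cast; ring)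
  have := (((((((z0.smul (a - 1)).add (z1.smul 1)).add (o0.smul (2 * a - 1))).add
    (o1.smul (2 - 2 * a))).add (o2.smul (-1))).add (t0.smul a)).add (t1.smul (-2 * a))).add
    (t2.smul a)
  convert this using 1
  · funext t; ring
  · ring

end GumbelAux

theorem gumbel_orthogonal_scale_reparam (μ σ : ℝ) (hσ : 0 < σ) :
    ∫ x : ℝ, (gumbelScoreMu μ σ x +
          ((1 - Real.eulerMascheroniConstant) /
              (Real.pi ^ 2 / 6 + Real.eulerMascheroniConstant ^ 2
                - 2 * Real.eulerMascheroniConstant + 1)) * gumbelScoreSigma μ σ x) *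
        gumbelScoreSigma μ σ x * gumbelPdf μ σ x = 0 := by
  set a := ((1 - Real.eulerMascheroniConstant) /
              (Real.pi ^ 2 / 6 + Real.eulerMascheroniConstant ^ 2
                - 2 * Real.eulerMascheroniConstant + 1)) with ha
  have hden : (Real.pi ^ 2 / 6 + Real.eulerMascheroniConstant ^ 2
                - 2 * Real.eulerMascheroniConstant + 1) ≠ 0 := by
    have : 0 < Real.pi ^ 2 / 6 := by positivity
    nlinarith [sq_nonneg (Real.eulerMascheroniConstant - 1)]
  have hmain := ((GumbelAux.main_HI a).smul (1 / σ ^ 2)).2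
  have hz : -(1 - Real.eulerMascheroniConstant) + a * (Real.pi ^ 2 / 6
      + Real.eulerMascheroniConstant ^ 2 - 2 * Real.eulerMascheroniConstant + 1) = 0 := by
    rw [ha, div_mul_cancel₀ _ hden]; ring
  rw [hz, mul_zero] at hmain
  have hder : ∀ x ∈ Set.univ, HasDerivWithinAt (fun x : ℝ => Real.exp (-((x - μ) / σ)))
      (-(1 / σ) * Real.exp (-((x - μ) / σ))) Set.univ x := by
    intro x _
    have := ((((hasDerivAt_id x).sub_const μ).div_const σ).neg).exp
    refine (this.congr_deriv ?_).hasDerivWithinAt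
    simp; ring
  have hinj : Set.InjOn (fun x : ℝ => Real.exp (-((x - μ) / σ))) Set.univ := by
    intro x _ y _ hxy
    have h1 : -((x - μ) / σ) = -((y - μ) / σ) := Real.exp_injective hxy
    have h2 := neg_injective h1
    rw [div_left_inj' hσ.ne'] at h2
    linarith
  have himg : (fun x : ℝ => Real.exp (-((x - μ) / σ))) '' Set.univ = Set.Ioi 0 := by
    ext t
    simp only [Set.image_univ, Set.mem_range, Set.mem_Ioi]
    constructor
    · rintro ⟨x, rfl⟩; positivity
    · intro ht
      refine ⟨μ - σ * Real.log t, ?_⟩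
      rw [show -((μ - σ * Real.log t - μ) / σ) = Real.log t by field_simp; ring, Real.exp_log ht]
  have hcv := integral_image_eq_integral_abs_deriv_smul MeasurableSet.univ hder hinj
    (fun t => 1 / σ ^ 2 * (((1 - t) + a * (-Real.log t * (1 - t) - 1)) *
      (-Real.log t * (1 - t) - 1) * Real.exp (-t)))
  rw [himg, hmain, setIntegral_univ] at hcv
  rw [hcv]
  congr 1
  funext x
  have habs : |-(1 / σ) * Real.exp (-((x - μ) / σ))| = (1 / σ) * Real.exp (-((x - μ) / σ)) := by
    rw [neg_mul, abs_neg, abs_of_pos (by positivity)]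
  rw [habs, Real.log_exp]
  unfold gumbelScoreMu gumbelScoreSigma gumbelPdf
  rw [smul_eq_mul]
  field_simp
end

section
/- Let σ > 0 and ξ > 0. Then the Fisher information entry i_{ξξ} of the GEV₂(σ,ξ) distribution satisfies ∫_0^∞ (s_ξ(x;σ,ξ))² · f(x;σ,ξ) dx = (1/ξ²)·(π²/6 + 1 − 2γ + γ²) + 2(1−γ)/ξ³ + 1/ξ⁴, where γ is the Euler–Mascheroni constant. -/
open MeasureTheory Real

/-- Density of the two-parameter GEV distribution GEV₂(σ,ξ), for x > 0 and ξ > 0. -/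
noncomputable def gev2Pdf (σ ξ x : ℝ) : ℝ :=
  (1 / σ) * (ξ * x / σ) ^ (-1 - 1 / ξ) * Real.exp (-(ξ * x / σ) ^ (-1 / ξ))

/-- Score of the GEV₂ distribution with respect to the shape parameter ξ. -/
noncomputable def gev2ScoreXi (σ ξ x : ℝ) : ℝ :=
  (1 / ξ ^ 2) * (Real.log (ξ * x / σ) - 1) * (1 - (ξ * x / σ) ^ (-1 / ξ)) - 1 / ξ

/-- The function `t ↦ (log t)^k exp(-t)`, complex valued. -/
noncomputable def gevPhi (k : ℕ) (t : ℝ) : ℂ := ((Real.log t ^ k * Real.exp (-t) : ℝ) : ℂ)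

lemma gevPhi_succ (k : ℕ) : gevPhi (k + 1) = fun t => Real.log t • gevPhi k t := by
  funext t
  simp only [gevPhi, Complex.real_smul]
  push_cast
  ring

open Asymptotics Filter Topology in
lemma gevPhi_top (k : ℕ) : ∀ a : ℝ, gevPhi k =O[atTop] (fun t : ℝ => t ^ (-a)) := by
  induction k with
  | zero =>
    intro a
    have : gevPhi 0 = fun t => ((Real.exp (-t) : ℝ) : ℂ) := by funext t; simp [gevPhi]
    rw [this, ← isBigO_norm_left]
    simp_rw [Complex.norm_real, isBigO_norm_left]
    simpa only [neg_one_mul] using (isLittleO_exp_neg_mul_rpow_atTop zero_lt_one _).isBigO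
  | succ k ih =>
    intro a
    rw [gevPhi_succ]
    exact isBigO_rpow_top_log_smul (lt_add_one a) (ih (a + 1))

open Asymptotics Filter Topology in
lemma gevPhi_bot (k : ℕ) : ∀ b : ℝ, 0 < b → gevPhi k =O[𝓝[>] 0] (fun t : ℝ => t ^ (-b)) := by
  suffices h : ∀ b : ℝ, 0 ≤ b → (k = 0 ∨ 0 < b) →
      gevPhi k =O[𝓝[>] 0] (fun t : ℝ => t ^ (-b)) from fun b hb => h b hb.le (Or.inr hb)
  induction k with
  | zero =>
    intro b hb _
    have h0 : gevPhi 0 =O[𝓝[>] 0] (fun t : ℝ => (1 : ℝ)) := by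
      have : gevPhi 0 = fun t => ((Real.exp (-t) : ℝ) : ℂ) := by funext t; simp [gevPhi]
      rw [this]
      refine isBigO_const_of_tendsto (?_ : Tendsto _ _ (𝓝 (1 : ℂ))) one_ne_zero
      rw [(by simp : (1 : ℂ) = Real.exp (-0))]
      exact (Complex.continuous_ofReal.comp
        (Real.continuous_exp.comp continuous_neg)).continuousWithinAt
    refine h0.trans ?_
    refine IsBigO.of_bound 1 ?_
    filter_upwards [Ioo_mem_nhdsGT (zero_lt_one : (0 : ℝ) < 1)] with t ht
    rw [one_mul, norm_one, Real.norm_of_nonneg (Real.rpow_nonneg ht.1.le _)]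
    exact Real.one_le_rpow_of_pos_of_le_one_of_nonpos ht.1 ht.2.le (by linarith)
  | succ k ih =>
    intro b _ hb
    have hb : 0 < b := by simpa using hb
    rw [gevPhi_succ]
    exact isBigO_rpow_zero_log_smul (half_lt_self hb) (ih (b / 2) (by linarith) (Or.inr (by linarith)))

lemma gevPhi_loc (k : ℕ) : LocallyIntegrableOn (gevPhi k) (Set.Ioi 0) := by
  refine ContinuousOn.locallyIntegrableOn ?_ measurableSet_Ioi
  unfold gevPhi
  refine Complex.continuous_ofReal.comp_continuousOn ?_
  refine ContinuousOn.mul (ContinuousOn.pow ?_ _) (by fun_prop)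
  exact Real.continuousOn_log.mono (fun x hx => ne_of_gt hx)

lemma gevPhi_conv (k : ℕ) (s : ℂ) (hs : 0 < s.re) : MellinConvergent (gevPhi k) s :=
  mellinConvergent_of_isBigO_rpow (gevPhi_loc k) (gevPhi_top k _) (lt_add_one _)
    (gevPhi_bot k _ (half_pos hs)) (half_lt_self hs)

/-- Derivatives of Gamma as Mellin transforms. -/
noncomputable def gevF (k : ℕ) (s : ℂ) : ℂ := mellin (gevPhi k) s

lemma gevF_deriv (k : ℕ) (s : ℂ) (hs : 0 < s.re) : HasDerivAt (gevF k) (gevF (k + 1) s) s := by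
  have h := (mellin_hasDerivAt_of_isBigO_rpow (gevPhi_loc k) (gevPhi_top k _) (lt_add_one _)
    (gevPhi_bot k _ (half_pos hs)) (half_lt_self hs)).2
  rw [← gevPhi_succ] at h
  exact h

lemma gevF_zero (s : ℂ) (hs : 0 < s.re) : gevF 0 s = Complex.Gamma s := by
  rw [Complex.Gamma_eq_integral hs, Complex.GammaIntegral_eq_mellin]
  unfold gevF
  congr 1
  funext t
  simp [gevPhi]

lemma gev_evt (s : ℂ) (hs : 0 < s.re) : ∀ᶠ z in nhds s, 0 < z.re :=
  (Complex.continuous_re.isOpen_preimage _ isOpen_Ioi).mem_nhds hs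

lemma gev_s_one (s : ℂ) (hs : 0 < s.re) : 0 < (s + 1).re := by
  simp; linarith

lemma gevF0_succ (s : ℂ) (hs : 0 < s.re) : gevF 0 (s + 1) = s * gevF 0 s := by
  rw [gevF_zero _ hs, gevF_zero _ (gev_s_one s hs), Complex.Gamma_add_one]
  rintro rfl
  simp at hs

lemma gevF1_succ (s : ℂ) (hs : 0 < s.re) : gevF 1 (s + 1) = gevF 0 s + s * gevF 1 s := by
  have h1 := (gevF_deriv 0 (s + 1) (gev_s_one s hs)).comp_add_const s 1
  have h2 := (hasDerivAt_id s).mul (gevF_deriv 0 s hs)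
  have h3 := h1.congr_of_eventuallyEq (f₁ := id * gevF 0)
    ((gev_evt s hs).mono fun z hz => (gevF0_succ z hz).symm)
  have := h3.unique h2
  simpa using this

lemma gevF2_succ (s : ℂ) (hs : 0 < s.re) : gevF 2 (s + 1) = 2 * gevF 1 s + s * gevF 2 s := by
  have h1 := (gevF_deriv 1 (s + 1) (gev_s_one s hs)).comp_add_const s 1
  have h2 := (gevF_deriv 0 s hs).add ((hasDerivAt_id s).mul (gevF_deriv 1 s hs))
  have h3 := h1.congr_of_eventuallyEq (f₁ := gevF 0 + id * gevF 1)
    ((gev_evt s hs).mono fun z hz => (gevF1_succ z hz).symm)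
  have := h3.unique h2
  simp at this
  rw [this]; ring

lemma gevF0_one : gevF 0 1 = 1 := by
  rw [gevF_zero _ (by simp), Complex.Gamma_one]

lemma gevF1_one : gevF 1 1 = -(Real.eulerMascheroniConstant : ℂ) := by
  refine ((gevF_deriv 0 1 (by simp)).congr_of_eventuallyEq ?_).unique Complex.hasDerivAt_Gamma_one
  exact (gev_evt 1 (by simp)).mono fun z hz => (gevF_zero z hz).symm

lemma gev_refl (s : ℂ) (h1 : 0 < (1 + s).re) (h2 : 0 < (1 - s).re) :
    gevF 0 (1 + s) * gevF 0 (1 - s) * Complex.sin (π * s) = π * s := by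
  rw [gevF_zero _ h1, gevF_zero _ h2]
  by_cases hs : s = 0
  · simp [hs]
  have h := Complex.Gamma_mul_Gamma_one_sub s
  have hsin : Complex.sin (π * s) ≠ 0 := by
    intro h0
    rw [h0, div_zero] at h
    rcases mul_eq_zero.mp h with h | h
    · have : Complex.Gamma (1 + s) = 0 := by
        rw [add_comm, Complex.Gamma_add_one _ hs, h, mul_zero]
      exact Complex.Gamma_ne_zero_of_re_pos h1 this
    · exact Complex.Gamma_ne_zero_of_re_pos h2 h
  rw [add_comm, Complex.Gamma_add_one _ hs, mul_assoc s, h, mul_assoc,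
    div_mul_cancel₀ _ hsin, mul_comm]

lemma gev_derivs (k : ℕ) (s : ℂ) (h1 : 0 < (1 + s).re) (h2 : 0 < (1 - s).re) :
    HasDerivAt (fun z => gevF k (1 + z)) (gevF (k + 1) (1 + s)) s ∧
    HasDerivAt (fun z => gevF k (1 - z)) (-gevF (k + 1) (1 - s)) s :=
  ⟨(gevF_deriv k (1 + s) h1).comp_const_add 1 s, (gevF_deriv k (1 - s) h2).comp_const_sub 1 s⟩

lemma gev_sin_d (s : ℂ) :
    HasDerivAt (fun z : ℂ => Complex.sin (π * z)) (π * Complex.cos (π * s)) s ∧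
    HasDerivAt (fun z : ℂ => Complex.cos (π * z)) (-π * Complex.sin (π * s)) s := by
  have h : HasDerivAt (fun z : ℂ => (π : ℂ) * z) π s := by
    simpa using (hasDerivAt_id s).const_mul (π : ℂ)
  refine ⟨?_, ?_⟩
  · convert h.csin using 1; ring
  · convert h.ccos using 1; ring

lemma gev_evt2 (s : ℂ) (h1 : 0 < (1 + s).re) (h2 : 0 < (1 - s).re) :
    ∀ᶠ z in nhds s, 0 < (1 + z).re ∧ 0 < (1 - z).re := by
  refine Filter.Eventually.and ?_ ?_
  · exact ((Complex.continuous_re.comp (continuous_const.add continuous_id)).isOpen_preimage _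
      isOpen_Ioi).mem_nhds h1
  · exact ((Complex.continuous_re.comp (continuous_const.sub continuous_id)).isOpen_preimage _
      isOpen_Ioi).mem_nhds h2

lemma gev_refl1 (s : ℂ) (h1 : 0 < (1 + s).re) (h2 : 0 < (1 - s).re) :
    (gevF 1 (1 + s) * gevF 0 (1 - s) - gevF 0 (1 + s) * gevF 1 (1 - s)) * Complex.sin (π * s)
      + gevF 0 (1 + s) * gevF 0 (1 - s) * (π * Complex.cos (π * s)) = π := by
  have a0 := gev_derivs 0 s h1 h2
  have hd := ((a0.1.mul a0.2).mul (gev_sin_d s).1)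
  have hr : HasDerivAt (fun z : ℂ => (π : ℂ) * z) π s := by
    simpa using (hasDerivAt_id s).const_mul (π : ℂ)
  have hc := hr.congr_of_eventuallyEq
    ((gev_evt2 s h1 h2).mono fun z hz => gev_refl z hz.1 hz.2)
  have := hd.unique hc
  simp only [Pi.mul_apply] at this
  linear_combination this

lemma gev_refl2 (s : ℂ) (h1 : 0 < (1 + s).re) (h2 : 0 < (1 - s).re) :
    (gevF 2 (1 + s) * gevF 0 (1 - s) - 2 * (gevF 1 (1 + s) * gevF 1 (1 - s))
        + gevF 0 (1 + s) * gevF 2 (1 - s)) * Complex.sin (π * s)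
      + 2 * π * ((gevF 1 (1 + s) * gevF 0 (1 - s) - gevF 0 (1 + s) * gevF 1 (1 - s))
        * Complex.cos (π * s))
      - π ^ 2 * (gevF 0 (1 + s) * gevF 0 (1 - s) * Complex.sin (π * s)) = 0 := by
  have a0 := gev_derivs 0 s h1 h2
  have a1 := gev_derivs 1 s h1 h2
  have sc := gev_sin_d s
  have hd := (((a1.1.mul a0.2).sub (a0.1.mul a1.2)).mul sc.1).add
    ((a0.1.mul a0.2).mul (sc.2.const_mul (π : ℂ)))
  have hc := (hasDerivAt_const s (π : ℂ)).congr_of_eventuallyEq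
    ((gev_evt2 s h1 h2).mono fun z hz => gev_refl1 z hz.1 hz.2)
  have := hd.unique hc
  simp only [Pi.mul_apply, Pi.sub_apply] at this
  linear_combination this

lemma gevF2_one : gevF 2 1 = (π : ℂ) ^ 2 / 6 + (Real.eulerMascheroniConstant : ℂ) ^ 2 := by
  have h1 : 0 < (1 + (0 : ℂ)).re := by simp
  have h2 : 0 < (1 - (0 : ℂ)).re := by simp
  have a0 := gev_derivs 0 0 h1 h2
  have a1 := gev_derivs 1 0 h1 h2
  have a2 := gev_derivs 2 0 h1 h2
  have sc := gev_sin_d 0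
  have hd := (((((a2.1.mul a0.2).sub ((a1.1.mul a1.2).const_mul 2)).add (a0.1.mul a2.2)).mul
    sc.1).add ((((a1.1.mul a0.2).sub (a0.1.mul a1.2)).mul sc.2).const_mul (2 * (π : ℂ)))).sub
    (((a0.1.mul a0.2).mul sc.1).const_mul ((π : ℂ) ^ 2))
  have hc := (hasDerivAt_const (0 : ℂ) (0 : ℂ)).congr_of_eventuallyEq
    ((gev_evt2 0 h1 h2).mono fun z hz => gev_refl2 z hz.1 hz.2)
  have := hd.unique hc
  simp [gevF0_one, gevF1_one] at this
  have hpi : (π : ℂ) ≠ 0 := by exact_mod_cast Real.pi_ne_zero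
  have h6 : (π : ℂ) * (gevF 2 1 - (π ^ 2 / 6 + (Real.eulerMascheroniConstant : ℂ) ^ 2)) = 0 := by
    linear_combination this / 6
  exact sub_eq_zero.mp ((mul_eq_zero.mp h6).resolve_left hpi)

/-- Real log-moments. -/
lemma gev_int (k n : ℕ) :
    IntegrableOn (fun t : ℝ => t ^ n * (Real.log t ^ k * Real.exp (-t))) (Set.Ioi 0) ∧
    ((∫ t in Set.Ioi (0 : ℝ), t ^ n * (Real.log t ^ k * Real.exp (-t)) : ℝ) : ℂ)
      = gevF k (n + 1) := by
  have hc : MellinConvergent (gevPhi k) (n + 1) := gevPhi_conv k _ (by simp; positivity)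
  have he : (fun t : ℝ => (t : ℂ) ^ ((n + 1 : ℂ) - 1) • gevPhi k t)
      = fun t : ℝ => ((t ^ n * (Real.log t ^ k * Real.exp (-t)) : ℝ) : ℂ) := by
    funext t
    simp [gevPhi]
  constructor
  · unfold MellinConvergent at hc
    rw [he] at hc
    exact hc.re
  · unfold gevF mellin
    rw [he, integral_complex_ofReal]

lemma gev_core (c : ℝ) :
    ∫ y in Set.Ioi (0 : ℝ), (Real.log y * (1 - y) + 1 + (1 - y) * c) ^ 2 * Real.exp (-y)
      = π ^ 2 / 6 + 1 - 2 * Real.eulerMascheroniConstant + Real.eulerMascheroniConstant ^ 2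
        + 2 * (1 - Real.eulerMascheroniConstant) * c + c ^ 2 := by
  let g := Real.eulerMascheroniConstant
  have e2 : gevF 0 2 = 1 := by
    have := gevF0_succ 1 (by simp); rw [one_add_one_eq_two, gevF0_one] at this; simpa using this
  have e3 : gevF 0 3 = 2 := by
    have := gevF0_succ 2 (by simp); rw [e2] at this; norm_num at this; exact this
  have f2 : gevF 1 2 = 1 - g := by
    have := gevF1_succ 1 (by simp); rw [one_add_one_eq_two, gevF0_one, gevF1_one] at this
    rw [this]; ring
  have f3 : gevF 1 3 = 3 - 2 * g := by
    have := gevF1_succ 2 (by simp); rw [e2, f2] at this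
    norm_num at this; rw [this]; ring
  have g2 : gevF 2 2 = π ^ 2 / 6 + g ^ 2 - 2 * g := by
    have := gevF2_succ 1 (by simp); rw [one_add_one_eq_two, gevF1_one, gevF2_one] at this
    rw [this]; ring
  have g3 : gevF 2 3 = 2 * (1 - g) + 2 * (π ^ 2 / 6 + g ^ 2 - 2 * g) := by
    have := gevF2_succ 2 (by simp); rw [f2, g2] at this
    norm_num at this; rw [this]
  let m : ℕ → ℕ → ℝ → ℝ := fun k n t => t ^ n * (Real.log t ^ k * Real.exp (-t))
  have key : ∀ (k n : ℕ) (v : ℝ), gevF k (n + 1) = (v : ℂ) →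
      IntegrableOn (m k n) (Set.Ioi 0) ∧ ∫ t in Set.Ioi (0 : ℝ), m k n t = v := by
    intro k n v hv
    refine ⟨(gev_int k n).1, ?_⟩
    have := (gev_int k n).2
    rw [hv] at this
    exact_mod_cast this
  have n1 : (1 : ℂ) + 1 = 2 := by norm_num
  have n2 : (2 : ℂ) + 1 = 3 := by norm_num
  obtain ⟨i00, v00⟩ := key 0 0 1 (by simp [gevF0_one])
  obtain ⟨i01, v01⟩ := key 0 1 1 (by simp [n1, e2])
  obtain ⟨i02, v02⟩ := key 0 2 2 (by simp [n2, e3])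
  obtain ⟨i10, v10⟩ := key 1 0 (-g) (by simp [gevF1_one, g])
  obtain ⟨i11, v11⟩ := key 1 1 (1 - g) (by simp [n1, f2])
  obtain ⟨i12, v12⟩ := key 1 2 (3 - 2 * g) (by simp [n2, f3])
  obtain ⟨i20, v20⟩ := key 2 0 (π ^ 2 / 6 + g ^ 2) (by simp [gevF2_one, g])
  obtain ⟨i21, v21⟩ := key 2 1 (π ^ 2 / 6 + g ^ 2 - 2 * g) (by simp [n1, g2])
  obtain ⟨i22, v22⟩ := key 2 2 (2 * (1 - g) + 2 * (π ^ 2 / 6 + g ^ 2 - 2 * g))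
    (by simp [n2, g3])
  -- (L(1-y) + 1 + (1-y)c)^2 expanded
  have hexp : ∀ y : ℝ, (Real.log y * (1 - y) + 1 + (1 - y) * c) ^ 2 * Real.exp (-y)
      = m 2 0 y + (-2) * m 2 1 y + 1 * m 2 2 y
        + (2 * (1 + c)) * m 1 0 y + (-2 * (1 + 2 * c)) * m 1 1 y + (2 * c) * m 1 2 y
        + (1 + c) ^ 2 * m 0 0 y + (-2 * c * (1 + c)) * m 0 1 y + c ^ 2 * m 0 2 y := by
    intro y
    simp only [m]
    ring
  simp_rw [hexp]
  have comb : ∀ (f h : ℝ → ℝ) (v w d : ℝ),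
      (IntegrableOn f (Set.Ioi 0) ∧ ∫ t in Set.Ioi (0 : ℝ), f t = v) →
      (IntegrableOn h (Set.Ioi 0) ∧ ∫ t in Set.Ioi (0 : ℝ), h t = w) →
      (IntegrableOn (fun t => f t + d * h t) (Set.Ioi 0) ∧
        ∫ t in Set.Ioi (0 : ℝ), (f t + d * h t) = v + d * w) := by
    intro f h v w d hf hh
    refine ⟨hf.1.add (hh.1.const_mul d), ?_⟩
    rw [integral_add hf.1 (hh.1.const_mul d), integral_const_mul, hf.2, hh.2]
  have t1 := comb _ _ _ _ (-2) ⟨i20, v20⟩ ⟨i21, v21⟩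
  have t2 := comb _ _ _ _ 1 t1 ⟨i22, v22⟩
  have t3 := comb _ _ _ _ (2 * (1 + c)) t2 ⟨i10, v10⟩
  have t4 := comb _ _ _ _ (-2 * (1 + 2 * c)) t3 ⟨i11, v11⟩
  have t5 := comb _ _ _ _ (2 * c) t4 ⟨i12, v12⟩
  have t6 := comb _ _ _ _ ((1 + c) ^ 2) t5 ⟨i00, v00⟩
  have t7 := comb _ _ _ _ (-2 * c * (1 + c)) t6 ⟨i01, v01⟩
  have t8 := comb _ _ _ _ (c ^ 2) t7 ⟨i02, v02⟩
  rw [t8.2]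
  simp only [g]
  ring


theorem gev2_fisher_xi_xi (σ ξ : ℝ) (hσ : 0 < σ) (hξ : 0 < ξ) :
    ∫ x in Set.Ioi (0 : ℝ), (gev2ScoreXi σ ξ x) ^ 2 * gev2Pdf σ ξ x
      = (1 / ξ ^ 2) * (Real.pi ^ 2 / 6 + 1 - 2 * Real.eulerMascheroniConstant
          + Real.eulerMascheroniConstant ^ 2)
        + 2 * (1 - Real.eulerMascheroniConstant) / ξ ^ 3 + 1 / ξ ^ 4 := by
  let g : ℝ → ℝ := fun y =>
    (Real.log y * (1 - y) + 1 + (1 - y) * (1 / ξ)) ^ 2 * Real.exp (-y) * (1 / ξ ^ 2)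
  have hp : (-1 / ξ) ≠ 0 := by
    have := hξ.ne'
    simp [this]
  have hsub := integral_comp_rpow_Ioi g hp
  have hscale := integral_comp_mul_left_Ioi
    (fun u : ℝ => (|-1 / ξ| * u ^ (-1 / ξ - 1)) • g (u ^ (-1 / ξ))) 0 (div_pos hξ hσ)
  rw [mul_zero, hsub] at hscale
  have hI : ∫ x in Set.Ioi (0 : ℝ), (gev2ScoreXi σ ξ x) ^ 2 * gev2Pdf σ ξ x
      = ∫ x in Set.Ioi (0 : ℝ), (ξ / σ) * ((|-1 / ξ| * (ξ / σ * x) ^ (-1 / ξ - 1)) •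
          g ((ξ / σ * x) ^ (-1 / ξ))) := by
    refine setIntegral_congr_fun measurableSet_Ioi fun x hx => ?_
    have hu : 0 < ξ / σ * x := mul_pos (div_pos hξ hσ) hx
    have e1 : ξ * x / σ = ξ / σ * x := by ring
    have e2 : |-1 / ξ| = 1 / ξ := by
      rw [neg_div, abs_neg, abs_of_pos (by positivity)]
    have e3 : (-1 / ξ - 1 : ℝ) = -1 - 1 / ξ := by ring
    simp only [gev2ScoreXi, gev2Pdf, g, smul_eq_mul]
    rw [e1, e2, e3, Real.log_rpow hu]
    generalize (ξ / σ * x) ^ (-1 / ξ) = y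
    generalize Real.log (ξ / σ * x) = L
    field_simp
    ring
  rw [hI, integral_const_mul, hscale]
  simp only [g, smul_eq_mul]
  rw [integral_mul_const, gev_core]
  field_simp
end

section
/- Let μ ∈ ℝ, σ > 0 and ξ > 0. Then the Fisher information entries of the three-parameter GP(μ,σ,ξ) distribution involving the location parameter satisfy: ∫_μ^∞ (s_μ(x;μ,σ,ξ))² · f(x;μ,σ,ξ) dx = (ξ+1)²/(σ²(1+2ξ)); ∫_μ^∞ s_μ(x;μ,σ,ξ)·s_σ(x;μ,σ,ξ) · f(x;μ,σ,ξ) dx = −ξ/(σ²(1+2ξ)); and ∫_μ^∞ s_μ(x;μ,σ,ξ)·s_ξ(x;μ,σ,ξ) · f(x;μ,σ,ξ) dx = −ξ/(σ(1+ξ)(1+2ξ)). -/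
open MeasureTheory Real

/-- Density of the three-parameter Generalised Pareto distribution GP(μ,σ,ξ), for x > μ. -/
noncomputable def gp3Pdf (μ σ ξ x : ℝ) : ℝ :=
  (1 / σ) * (1 + ξ * (x - μ) / σ) ^ (-1 - 1 / ξ)

/-- Score of the three-parameter GP distribution with respect to the location parameter μ. -/
noncomputable def gp3ScoreMu (μ σ ξ x : ℝ) : ℝ :=
  (1 + ξ) / (σ + ξ * (x - μ))

/-- Score of the three-parameter GP distribution with respect to the scale parameter σ. -/
noncomputable def gp3ScoreSigma (μ σ ξ x : ℝ) : ℝ :=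
  -1 / σ + (1 + ξ) * (x - μ) / (σ * (σ + ξ * (x - μ)))

/-- Score of the three-parameter GP distribution with respect to the shape parameter ξ. -/
noncomputable def gp3ScoreXi (μ σ ξ x : ℝ) : ℝ :=
  (1 / ξ ^ 2) * Real.log (1 + ξ * (x - μ) / σ) - (1 + 1 / ξ) * (x - μ) / (σ + ξ * (x - μ))

lemma gp3_aux_pos (μ σ ξ x : ℝ) (hσ : 0 < σ) (hξ : 0 < ξ) (hx : μ ≤ x) :
    1 ≤ 1 + ξ * (x - μ) / σ := by
  have : 0 ≤ ξ * (x - μ) / σ := div_nonneg (mul_nonneg hξ.le (by linarith)) hσ.le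
  linarith

lemma gp3_aux_tendsto (μ σ ξ : ℝ) (hσ : 0 < σ) (hξ : 0 < ξ) :
    Filter.Tendsto (fun x : ℝ => 1 + ξ * (x - μ) / σ) Filter.atTop Filter.atTop := by
  apply Filter.tendsto_atTop_add_const_left
  apply Filter.Tendsto.atTop_div_const hσ
  apply Filter.Tendsto.const_mul_atTop hξ
  exact Filter.tendsto_atTop_add_const_right _ (-μ) Filter.tendsto_id

lemma gp3_aux_deriv (μ σ ξ x : ℝ) :
    HasDerivAt (fun x : ℝ => 1 + ξ * (x - μ) / σ) (ξ / σ) x := by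
  have := ((((hasDerivAt_id x).sub_const μ).const_mul ξ).div_const σ).const_add 1
  simpa using this

lemma gp3_aux_pow (μ σ ξ p : ℝ) (hσ : 0 < σ) (hξ : 0 < ξ) (hp : 0 < p) :
    IntegrableOn (fun x => (1 + ξ * (x - μ) / σ) ^ (-p - 1)) (Set.Ioi μ) ∧
    ∫ x in Set.Ioi μ, (1 + ξ * (x - μ) / σ) ^ (-p - 1) = σ / (ξ * p) := by
  have hd : ∀ x ∈ Set.Ici μ, HasDerivAt
      (fun x => -(σ / (ξ * p)) * (1 + ξ * (x - μ) / σ) ^ (-p))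
      ((1 + ξ * (x - μ) / σ) ^ (-p - 1)) x := by
    intro x hx
    have h1 := gp3_aux_pos μ σ ξ x hσ hξ hx
    have := (((gp3_aux_deriv μ σ ξ x).rpow_const (p := -p)
      (Or.inl (by linarith)))).const_mul (-(σ / (ξ * p)))
    refine HasDerivAt.congr_deriv (f := _) this ?_
    have h0 : 0 < 1 + ξ * (x - μ) / σ := by linarith
    generalize 1 + ξ * (x - μ) / σ = y at *
    field_simp
  have hn : ∀ x ∈ Set.Ioi μ, 0 ≤ (1 + ξ * (x - μ) / σ) ^ (-p - 1) := by
    intro x hx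
    have h1 := gp3_aux_pos μ σ ξ x hσ hξ (le_of_lt hx)
    exact rpow_nonneg (by linarith) _
  have ht : Filter.Tendsto (fun x => -(σ / (ξ * p)) * (1 + ξ * (x - μ) / σ) ^ (-p))
      Filter.atTop (nhds (-(σ / (ξ * p)) * 0)) :=
    ((tendsto_rpow_neg_atTop hp).comp (gp3_aux_tendsto μ σ ξ hσ hξ)).const_mul _
  refine ⟨integrableOn_Ioi_deriv_of_nonneg' hd hn ht, ?_⟩
  rw [integral_Ioi_of_hasDerivAt_of_nonneg' hd hn ht]
  simp

lemma gp3_aux_log (μ σ ξ p : ℝ) (hσ : 0 < σ) (hξ : 0 < ξ) (hp : 0 < p) :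
    IntegrableOn (fun x => Real.log (1 + ξ * (x - μ) / σ) * (1 + ξ * (x - μ) / σ) ^ (-p - 1))
      (Set.Ioi μ) ∧
    ∫ x in Set.Ioi μ, Real.log (1 + ξ * (x - μ) / σ) * (1 + ξ * (x - μ) / σ) ^ (-p - 1)
      = σ / (ξ * p ^ 2) := by
  have hd : ∀ x ∈ Set.Ici μ, HasDerivAt
      (fun x => -(σ / (ξ * p)) * (Real.log (1 + ξ * (x - μ) / σ) * (1 + ξ * (x - μ) / σ) ^ (-p))
        + -(σ / (ξ * p ^ 2)) * (1 + ξ * (x - μ) / σ) ^ (-p))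
      (Real.log (1 + ξ * (x - μ) / σ) * (1 + ξ * (x - μ) / σ) ^ (-p - 1)) x := by
    intro x hx
    have h1 := gp3_aux_pos μ σ ξ x hσ hξ hx
    have hy := gp3_aux_deriv μ σ ξ x
    have hr := hy.rpow_const (p := -p) (Or.inl (by linarith))
    have hl := hy.log (by linarith)
    have := ((hl.mul hr).const_mul (-(σ / (ξ * p)))).add (hr.const_mul (-(σ / (ξ * p ^ 2))))
    refine HasDerivAt.congr_deriv (f := _) this ?_
    have h0 : 0 < 1 + ξ * (x - μ) / σ := by linarith
    generalize 1 + ξ * (x - μ) / σ = y at *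
    rw [rpow_sub_one h0.ne']
    field_simp
    ring
  have hn : ∀ x ∈ Set.Ioi μ,
      0 ≤ Real.log (1 + ξ * (x - μ) / σ) * (1 + ξ * (x - μ) / σ) ^ (-p - 1) := by
    intro x hx
    have h1 := gp3_aux_pos μ σ ξ x hσ hξ (le_of_lt hx)
    exact mul_nonneg (log_nonneg h1) (rpow_nonneg (by linarith) _)
  have hlt : Filter.Tendsto (fun y : ℝ => Real.log y * y ^ (-p)) Filter.atTop (nhds 0) := by
    refine ((isLittleO_log_rpow_atTop hp).tendsto_div_nhds_zero).congr' ?_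
    filter_upwards [Filter.eventually_gt_atTop 0] with y hy
    rw [rpow_neg hy.le, div_eq_mul_inv]
  have ht : Filter.Tendsto (fun x =>
      -(σ / (ξ * p)) * (Real.log (1 + ξ * (x - μ) / σ) * (1 + ξ * (x - μ) / σ) ^ (-p))
        + -(σ / (ξ * p ^ 2)) * (1 + ξ * (x - μ) / σ) ^ (-p))
      Filter.atTop (nhds (-(σ / (ξ * p)) * 0 + -(σ / (ξ * p ^ 2)) * 0)) :=
    ((hlt.comp (gp3_aux_tendsto μ σ ξ hσ hξ)).const_mul _).add
      (((tendsto_rpow_neg_atTop hp).comp (gp3_aux_tendsto μ σ ξ hσ hξ)).const_mul _)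
  refine ⟨integrableOn_Ioi_deriv_of_nonneg' hd hn ht, ?_⟩
  rw [integral_Ioi_of_hasDerivAt_of_nonneg' hd hn ht]
  simp

theorem gp3_fisher_location_entries (μ σ ξ : ℝ) (hσ : 0 < σ) (hξ : 0 < ξ) :
    (∫ x in Set.Ioi μ, (gp3ScoreMu μ σ ξ x) ^ 2 * gp3Pdf μ σ ξ x
        = (ξ + 1) ^ 2 / (σ ^ 2 * (1 + 2 * ξ)))
    ∧ (∫ x in Set.Ioi μ, gp3ScoreMu μ σ ξ x * gp3ScoreSigma μ σ ξ x * gp3Pdf μ σ ξ x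
        = -ξ / (σ ^ 2 * (1 + 2 * ξ)))
    ∧ (∫ x in Set.Ioi μ, gp3ScoreMu μ σ ξ x * gp3ScoreXi μ σ ξ x * gp3Pdf μ σ ξ x
        = -ξ / (σ * (1 + ξ) * (1 + 2 * ξ))) := by
  have hp1 : 0 < 1 + 1 / ξ := by positivity
  have hp2 : 0 < 2 + 1 / ξ := by positivity
  obtain ⟨i1, e1⟩ := gp3_aux_pow μ σ ξ _ hσ hξ hp1
  obtain ⟨i2, e2⟩ := gp3_aux_pow μ σ ξ _ hσ hξ hp2
  obtain ⟨il, el⟩ := gp3_aux_log μ σ ξ _ hσ hξ hp1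
  have key : ∀ x ∈ Set.Ioi μ, ∃ y : ℝ, 0 < y ∧ 1 + ξ * (x - μ) / σ = y ∧
      x - μ = σ * (y - 1) / ξ ∧ σ + ξ * (x - μ) = σ * y ∧
      y ^ (-(1 + 1 / ξ) - 1) = y ^ (-1 - 1 / ξ) / y ∧
      y ^ (-(2 + 1 / ξ) - 1) = y ^ (-1 - 1 / ξ) / y / y := by
    intro x hx
    have h1 := gp3_aux_pos μ σ ξ x hσ hξ (le_of_lt hx)
    have h0 : 0 < 1 + ξ * (x - μ) / σ := by linarith
    refine ⟨_, h0, rfl, ?_, ?_, ?_, ?_⟩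
    · field_simp
      ring
    · field_simp
    · rw [← rpow_sub_one h0.ne']
      congr 1
      ring
    · rw [← rpow_sub_one h0.ne', ← rpow_sub_one h0.ne']
      congr 1
      ring
  refine ⟨?_, ?_, ?_⟩
  · rw [setIntegral_congr_fun (g := fun x => ((1 + ξ) ^ 2 / σ ^ 3) *
      (1 + ξ * (x - μ) / σ) ^ (-(2 + 1 / ξ) - 1)) measurableSet_Ioi]
    · rw [integral_const_mul, e2]
      field_simp
      ring
    · intro x hx
      obtain ⟨y, hy, h1, h2, h3, h4, h5⟩ := key x hx
      simp only [gp3ScoreMu, gp3Pdf, h1, h3, h5]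
      field_simp
  · rw [setIntegral_congr_fun (g := fun x => ((1 + ξ) / (σ ^ 3 * ξ)) *
      (1 + ξ * (x - μ) / σ) ^ (-(1 + 1 / ξ) - 1) - ((1 + ξ) ^ 2 / (σ ^ 3 * ξ)) *
      (1 + ξ * (x - μ) / σ) ^ (-(2 + 1 / ξ) - 1)) measurableSet_Ioi]
    · rw [integral_sub (i1.const_mul _) (i2.const_mul _), integral_const_mul,
        integral_const_mul, e1, e2]
      field_simp
      ring
    · intro x hx
      obtain ⟨y, hy, h1, h2, h3, h4, h5⟩ := key x hx
      simp only [gp3ScoreMu, gp3ScoreSigma, gp3Pdf, h1, h3, h4, h5]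
      rw [h2]
      generalize y ^ (-1 - 1 / ξ) = w
      field_simp
      ring
  · rw [setIntegral_congr_fun (g := fun x => ((1 + ξ) / (σ ^ 2 * ξ ^ 2)) *
      (Real.log (1 + ξ * (x - μ) / σ) * (1 + ξ * (x - μ) / σ) ^ (-(1 + 1 / ξ) - 1))
      - (((1 + ξ) ^ 2 / (σ ^ 2 * ξ ^ 2)) *
      (1 + ξ * (x - μ) / σ) ^ (-(1 + 1 / ξ) - 1) - ((1 + ξ) ^ 2 / (σ ^ 2 * ξ ^ 2)) *
      (1 + ξ * (x - μ) / σ) ^ (-(2 + 1 / ξ) - 1))) measurableSet_Ioi]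
    · have i12 : IntegrableOn (fun x => ((1 + ξ) ^ 2 / (σ ^ 2 * ξ ^ 2)) *
          (1 + ξ * (x - μ) / σ) ^ (-(1 + 1 / ξ) - 1) - ((1 + ξ) ^ 2 / (σ ^ 2 * ξ ^ 2)) *
          (1 + ξ * (x - μ) / σ) ^ (-(2 + 1 / ξ) - 1)) (Set.Ioi μ) :=
        (i1.const_mul _).sub (i2.const_mul _)
      rw [integral_sub (il.const_mul _) i12,
        integral_sub (i1.const_mul _) (i2.const_mul _), integral_const_mul,
        integral_const_mul, integral_const_mul, e1, e2, el]
      have h1 : 1 + 1 / ξ = (1 + ξ) / ξ := by field_simp; ring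
      have h2 : 2 + 1 / ξ = (1 + 2 * ξ) / ξ := by field_simp; ring
      rw [h1, h2]
      field_simp
      ring
    · intro x hx
      obtain ⟨y, hy, h1, h2, h3, h4, h5⟩ := key x hx
      simp only [gp3ScoreMu, gp3ScoreXi, gp3Pdf, h1, h3, h4, h5]
      rw [h2]
      generalize y ^ (-1 - 1 / ξ) = w
      field_simp
      ring
end
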